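/- Let t > 0 and let g : (0,∞) → ℝ be a Borel function with E[|g(τ)|] < ∞. Then ℙ-a.s., E[g(τ) | F_t^{ξ,c}] = g(τ ∧ t) · 1_{{ξ_t = 0}} + ∫_{(t,∞)} g(r) ϕ_{ξ^r_t}(ξ_t) ℙ_τ(dr) · 1_{{ξ_t ≠ 0}}. -/

import Mathlib

open MeasureTheory ProbabilityTheory Real Set

section Sup

variable {Ω : Type*} {m₁ m₂ : MeasurableSpace Ω}

theorem isPiSystem_image2_inter_measurableSet (m₁ m₂ : MeasurableSpace Ω) :
    IsPiSystem (image2 (· ∩ ·) {s | MeasurableSet[m₁] s} {s | MeasurableSet[m₂] s}) := by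
  rintro _ ⟨a, ha, b, hb, rfl⟩ _ ⟨c, hc, d, hd, rfl⟩ -
  exact ⟨a ∩ c, MeasurableSet.inter ha hc, b ∩ d, MeasurableSet.inter hb hd,
    inter_inter_inter_comm a c b d⟩

theorem sup_eq_generateFrom_image2_inter (m₁ m₂ : MeasurableSpace Ω) :
    m₁ ⊔ m₂ = MeasurableSpace.generateFrom
      (image2 (· ∩ ·) {s | MeasurableSet[m₁] s} {s | MeasurableSet[m₂] s}) := by
  apply le_antisymm
  · refine sup_le (fun s hs => ?_) (fun s hs => ?_)
    · exact MeasurableSpace.measurableSet_generateFrom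
        ⟨s, hs, univ, MeasurableSet.univ, inter_univ s⟩
    · exact MeasurableSpace.measurableSet_generateFrom
        ⟨univ, MeasurableSet.univ, s, hs, univ_inter s⟩
  · refine MeasurableSpace.generateFrom_le ?_
    rintro _ ⟨a, ha, b, hb, rfl⟩
    exact MeasurableSet.inter (le_sup_left (a := m₁) (b := m₂) a ha)
      (le_sup_right (a := m₁) (b := m₂) b hb)

theorem ProbabilityTheory.Indep.sup_right_of_indep {m₃ mΩ : MeasurableSpace Ω} {P : Measure Ω}
    [IsProbabilityMeasure P] (h₁ : m₁ ≤ mΩ) (h₂ : m₂ ≤ mΩ) (h₃ : m₃ ≤ mΩ)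
    (h₁₂ : Indep m₁ m₂ P) (h : Indep m₃ (m₁ ⊔ m₂) P) : Indep m₁ (m₃ ⊔ m₂) P := by
  refine IndepSets.indep (p1 := {s | MeasurableSet[m₁] s}) h₁ (sup_le h₃ h₂)
    (@MeasurableSpace.isPiSystem_measurableSet _ m₁)
    (isPiSystem_image2_inter_measurableSet m₃ m₂)
    (@MeasurableSpace.generateFrom_measurableSet _ m₁).symm
    (sup_eq_generateFrom_image2_inter m₃ m₂) ?_
  rw [IndepSets_iff]
  rintro a _ ha ⟨c, hc, b, hb, rfl⟩
  rw [Indep_iff] at h₁₂ h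
  have hb' := le_sup_right (a := m₁) (b := m₂) b hb
  have ha' := le_sup_left (a := m₁) (b := m₂) a ha
  have hab := MeasurableSet.inter ha' hb'
  change P (a ∩ (c ∩ b)) = P a * P (c ∩ b)
  rw [inter_left_comm, h c _ hc hab, h₁₂ a b ha hb, h c b hc hb']
  ring

theorem setIntegral_eq_zero_of_indep {m₃ mΩ : MeasurableSpace Ω} {P : Measure Ω}
    [IsProbabilityMeasure P]
    (h₁ : m₁ ≤ mΩ) (h₂ : m₂ ≤ mΩ) (h₃₂ : m₃ ≤ m₂) (hindep : Indep m₁ m₂ P) {h : Ω → ℝ}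
    (hm : StronglyMeasurable[m₂] h) (hint : Integrable h P)
    (hzero : ∀ s, MeasurableSet[m₃] s → ∫ ω in s, h ω ∂P = 0)
    {s : Set Ω} (hs : MeasurableSet[m₁ ⊔ m₃] s) : ∫ ω in s, h ω ∂P = 0 := by
  have hle : m₁ ⊔ m₃ ≤ mΩ := sup_le h₁ (h₃₂.trans h₂)
  refine MeasurableSpace.induction_on_inter (m := m₁ ⊔ m₃)
    (C := fun s _ => ∫ ω in s, h ω ∂P = 0) (sup_eq_generateFrom_image2_inter m₁ m₃)
    (isPiSystem_image2_inter_measurableSet m₁ m₃) (by simp) ?_ ?_ ?_ s hs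
  · rintro _ ⟨a, ha, b, hb, rfl⟩
    change ∫ ω in a ∩ b, h ω ∂P = 0
    have hb2 : MeasurableSet[m₂] b := h₃₂ b hb
    have hb' : MeasurableSet b := h₂ b hb2
    rw [← setIntegral_indicator hb',
      ← setIntegral_condExp h₁ (hint.indicator hb') ha,
      setIntegral_congr_ae (g := fun _ => ∫ ω, b.indicator h ω ∂P) (h₁ a ha)
        ((condExp_indep_eq h₂ h₁ (hm.indicator hb2) hindep.symm).mono fun _ h _ => h),
      integral_indicator hb', hzero b hb]
    simp
  · intro s hs h0
    have := integral_add_compl (hle s hs) hint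
    rw [h0, zero_add] at this
    rw [this, ← setIntegral_univ]
    exact hzero univ MeasurableSet.univ
  · intro f hd hf h0
    rw [integral_iUnion (fun i => hle _ (hf i)) hd hint.integrableOn]
    simp [h0]

end Sup

section Bayes

variable {α β : Type*} {mα : MeasurableSpace α} {mβ : MeasurableSpace β}

theorem map_restrict_prodMk_eq_withDensity {Ω Ω' γ : Type*} {mΩ : MeasurableSpace Ω}
    {mΩ' : MeasurableSpace Ω'} {mγ : MeasurableSpace γ} {P : Measure Ω} [IsProbabilityMeasure P]
    {T : Ω → α} {W : Ω → Ω'} (hT : Measurable T) (hW : Measurable W) (hTW : IndepFun T W P)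
    {Z : α × Ω' → γ} (hZ : Measurable Z) {ν : Measure γ} [SFinite ν] {f : α × γ → ENNReal}
    (hf : Measurable f) {S : Set α} (hS : MeasurableSet S)
    (hlaw : ∀ r ∈ S, P.map (fun ω => Z (r, W ω)) = ν.withDensity (fun x => f (r, x))) :
    (P.restrict (T ⁻¹' S)).map (fun ω => (T ω, Z (T ω, W ω))) =
      (((P.map T).restrict S).prod ν).withDensity f := by
  have : IsProbabilityMeasure (P.map T) := Measure.isProbabilityMeasure_map hT.aemeasurable
  have : IsProbabilityMeasure (P.map W) := Measure.isProbabilityMeasure_map hW.aemeasurable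
  ext E hE
  have hm : Measurable (fun ω => (T ω, Z (T ω, W ω))) := by fun_prop
  have hZ' : Measurable (fun p : α × Ω' => (p.1, Z p)) := by fun_prop
  have hE' : MeasurableSet ({p : α × Ω' | p.1 ∈ S} ∩ (fun p : α × Ω' => (p.1, Z p)) ⁻¹' E) :=
    (measurable_fst hS).inter (hZ' hE)
  have e : (fun ω => (T ω, Z (T ω, W ω))) ⁻¹' E ∩ T ⁻¹' S = (fun ω => (T ω, W ω)) ⁻¹'
      ({p : α × Ω' | p.1 ∈ S} ∩ (fun p : α × Ω' => (p.1, Z p)) ⁻¹' E) := by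
    ext ω; simp [and_comm]
  rw [Measure.map_apply hm hE, Measure.restrict_apply (hm hE), e,
    ← Measure.map_apply (hT.prodMk hW) hE',
    (indepFun_iff_map_prod_eq_prod_map_map hT.aemeasurable hW.aemeasurable).1 hTW,
    Measure.prod_apply hE', withDensity_apply _ hE, ← lintegral_indicator hE,
    lintegral_prod _ (hf.indicator hE).aemeasurable, ← lintegral_indicator hS]
  refine lintegral_congr fun r => ?_
  by_cases hr : r ∈ S
  · rw [indicator_of_mem hr]
    have hsec : MeasurableSet (Prod.mk r ⁻¹' E) := measurable_prodMk_left hE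
    have hZr : Measurable fun ω' => Z (r, ω') := hZ.comp measurable_prodMk_left
    have e2 : Prod.mk r ⁻¹' ({p : α × Ω' | p.1 ∈ S} ∩ (fun p : α × Ω' => (p.1, Z p)) ⁻¹' E) =
        (fun ω' => Z (r, ω')) ⁻¹' (Prod.mk r ⁻¹' E) := by
      ext ω; simp [hr]
    rw [e2, Measure.map_apply hW (hZr hsec), ← preimage_comp,
      ← Measure.map_apply (hZr.comp hW) hsec]
    change P.map (fun ω => Z (r, W ω)) _ = _
    rw [hlaw r hr, withDensity_apply _ hsec, ← lintegral_indicator hsec]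
    rfl
  · rw [indicator_of_notMem hr]
    have e2 : Prod.mk r ⁻¹' ({p : α × Ω' | p.1 ∈ S} ∩ (fun p : α × Ω' => (p.1, Z p)) ⁻¹' E) =
        ∅ := by
      ext ω; simp [hr]
    rw [e2, measure_empty]

theorem mul_bayes_eq {μ : Measure α} {f g : α → ℝ} (hf0 : 0 ≤ f) (hf : Integrable f μ) :
    (∫ r, f r ∂μ) * ((∫ r, g r * f r ∂μ) / ∫ r, f r ∂μ) = ∫ r, f r * g r ∂μ := by
  by_cases hc : ∫ r, f r ∂μ = 0
  · rw [hc, zero_mul]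
    rw [integral_eq_zero_iff_of_nonneg hf0 hf] at hc
    rw [integral_congr_ae (g := 0)]
    · simp
    · filter_upwards [hc] with r hr
      simp [hr]
  · rw [mul_div_cancel₀ _ hc]
    simp only [mul_comm]

variable {μ : Measure α} {ν : Measure β} [SFinite μ] [SFinite ν] {f : α × β → ℝ} {g : α → ℝ}

theorem measurable_bayes (hf : Measurable f) (hg : Measurable g) :
    Measurable fun x => (∫ r, g r * f (r, x) ∂μ) / ∫ r, f (r, x) ∂μ := by
  have h1 : Measurable fun x => ∫ r, g r * f (r, x) ∂μ :=
    (((hg.comp measurable_snd).mul (hf.comp measurable_swap)).stronglyMeasurable.integral_prod_right'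
      (f := fun p : β × α => g p.2 * f (p.2, p.1))).measurable
  have h2 : Measurable fun x => ∫ r, f (r, x) ∂μ :=
    ((hf.comp measurable_swap).stronglyMeasurable.integral_prod_right'
      (f := fun p : β × α => f (p.2, p.1))).measurable
  exact h1.div h2

theorem integrable_bayes (hf : Measurable f) (hf0 : 0 ≤ f)
    [IsFiniteMeasure ((μ.prod ν).withDensity fun z => ENNReal.ofReal (f z))] (hg : Measurable g)
    (hgi : Integrable (fun z => g z.1) ((μ.prod ν).withDensity fun z => ENNReal.ofReal (f z))) :
    Integrable (fun z : α × β => (∫ r, g r * f (r, z.2) ∂μ) / ∫ r, f (r, z.2) ∂μ)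
      ((μ.prod ν).withDensity fun z => ENNReal.ofReal (f z)) := by
  have h1 := integrable_const (μ := (μ.prod ν).withDensity fun z => ENNReal.ofReal (f z)) (1 : ℝ)
  rw [integrable_withDensity_iff_integrable_smul' (by fun_prop) (by simp)] at hgi h1 ⊢
  simp only [ENNReal.toReal_ofReal (hf0 _), smul_eq_mul, mul_one] at hgi h1 ⊢
  have hH := measurable_bayes (μ := μ) hf hg
  have hm : Measurable fun z : α × β =>
      f z * ((∫ r, g r * f (r, z.2) ∂μ) / ∫ r, f (r, z.2) ∂μ) := hf.mul (hH.comp measurable_snd)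
  refine (integrable_prod_iff' hm.aestronglyMeasurable).2 ⟨?_, ?_⟩
  · filter_upwards [h1.prod_left_ae] with x hx
    exact hx.mul_const _
  · refine hgi.integral_prod_right.norm.congr ?_
    filter_upwards [h1.prod_left_ae] with x hx
    simp only [norm_mul, integral_mul_const, norm_of_nonneg (hf0 _)]
    rw [← mul_bayes_eq (f := fun r => f (r, x)) (fun r => hf0 _) hx, norm_mul,
      norm_of_nonneg (integral_nonneg (f := fun r => f (r, x)) fun r => hf0 _)]

theorem setIntegral_bayes (hf : Measurable f) (hf0 : 0 ≤ f)
    [IsFiniteMeasure ((μ.prod ν).withDensity fun z => ENNReal.ofReal (f z))] (hg : Measurable g)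
    (hgi : Integrable (fun z => g z.1) ((μ.prod ν).withDensity fun z => ENNReal.ofReal (f z)))
    {B : Set β} (hB : MeasurableSet B) :
    ∫ z in Prod.snd ⁻¹' B, (∫ r, g r * f (r, z.2) ∂μ) / ∫ r, f (r, z.2) ∂μ
        ∂((μ.prod ν).withDensity fun z => ENNReal.ofReal (f z)) =
      ∫ z in Prod.snd ⁻¹' B, g z.1 ∂((μ.prod ν).withDensity fun z => ENNReal.ofReal (f z)) := by
  have hHi := integrable_bayes hf hf0 hg hgi
  have h1 := integrable_const (μ := (μ.prod ν).withDensity fun z => ENNReal.ofReal (f z)) (1 : ℝ)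
  rw [integrable_withDensity_iff_integrable_smul' (by fun_prop) (by simp)] at hgi h1 hHi
  simp only [ENNReal.toReal_ofReal (hf0 _), smul_eq_mul, mul_one] at hgi h1 hHi
  have hr : (μ.prod ν).restrict (Prod.snd ⁻¹' B) = μ.prod (ν.restrict B) := by
    rw [← univ_prod, ← Measure.prod_restrict, Measure.restrict_univ]
  rw [restrict_withDensity (measurable_snd hB),
    integral_withDensity_eq_integral_toReal_smul (by fun_prop) (by simp),
    integral_withDensity_eq_integral_toReal_smul (by fun_prop) (by simp)]
  simp only [ENNReal.toReal_ofReal (hf0 _), smul_eq_mul]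
  have hgi' := hgi.restrict (s := Prod.snd ⁻¹' B)
  have hHi' := hHi.restrict (s := Prod.snd ⁻¹' B)
  rw [hr] at hgi' hHi' ⊢
  rw [integral_prod_symm _ hgi', integral_prod_symm _ hHi']
  refine integral_congr_ae (ae_restrict_of_ae ?_)
  filter_upwards [h1.prod_left_ae] with x hx
  simp only [integral_mul_const]
  exact mul_bayes_eq (fun r => hf0 _) hx

end Bayes

section Gaussian

variable {Ω : Type*} {mΩ : MeasurableSpace Ω} {P : Measure Ω} {X : ℝ → Ω → ℝ}

theorem isGaussianProcess_of_forall_sum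
    (hGauss : ∀ (m : ℕ) (ts : Fin m → ℝ), (∀ i, 0 ≤ ts i) → ∀ c : Fin m → ℝ,
      ∃ v : NNReal, Measure.map (fun ω => ∑ i, c i * X (ts i) ω) P = gaussianReal 0 v)
    (hXmeas : ∀ t, Measurable (X t)) :
    IsGaussianProcess (fun u : Ici (0 : ℝ) => X u) P := by
  refine ⟨fun I => ⟨isGaussian_of_map_eq_gaussianReal fun L => ?_⟩⟩
  have e := I.equivFin
  obtain ⟨v, hv⟩ := hGauss _ (fun k => ((e.symm k : I) : Ici (0 : ℝ)))
    (fun k => (e.symm k : I).1.2) (fun k => L (Pi.single (e.symm k) 1))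
  refine ⟨0, v, ?_⟩
  have hm : Measurable fun ω => I.restrict fun u : Ici (0 : ℝ) => X u ω :=
    measurable_pi_lambda _ fun i => hXmeas _
  rw [Measure.map_map L.continuous.measurable hm, ← hv]
  congr 1
  ext ω
  simp only [Function.comp_apply]
  rw [Equiv.sum_comp e.symm fun i : I => L (Pi.single i 1) * X i ω]
  conv_lhs => rw [pi_eq_sum_univ' (I.restrict fun u : Ici (0 : ℝ) => X u ω)]
  simp [mul_comm, Finset.restrict]

theorem integral_eq_zero_of_forall_sum
    (hGauss : ∀ (m : ℕ) (ts : Fin m → ℝ), (∀ i, 0 ≤ ts i) → ∀ c : Fin m → ℝ,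
      ∃ v : NNReal, Measure.map (fun ω => ∑ i, c i * X (ts i) ω) P = gaussianReal 0 v)
    (hXmeas : ∀ t, Measurable (X t)) {u : ℝ} (hu : 0 ≤ u) : ∫ ω, X u ω ∂P = 0 := by
  obtain ⟨v, hv⟩ := hGauss 1 (fun _ => u) (fun _ => hu) (fun _ => 1)
  simp only [Finset.univ_unique, Finset.sum_singleton, one_mul] at hv
  have : ∫ x, x ∂(P.map (X u)) = ∫ ω, X u ω ∂P :=
    integral_map (hXmeas u).aemeasurable (by fun_prop)
  rw [← this, hv, integral_id_gaussianReal]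

/-- The bridge of length `r` of a process with covariance `ρ (min s t) * q (max s t)`. -/
noncomputable def markovBridge (ρ : ℝ → ℝ) (X : ℝ → Ω → ℝ) (s r : ℝ) (ω : Ω) : ℝ :=
  X s ω - ρ s / ρ (max r s) * X (max r s) ω

theorem markovBridge_eq_add {ρ : ℝ → ℝ} {s t r : ℝ} (hst : s ≤ t) (htr : t ≤ r) (ht : ρ t ≠ 0)
    (ω : Ω) :
    markovBridge ρ X s r ω = (X s ω - ρ s / ρ t * X t ω) + ρ s / ρ t * markovBridge ρ X t r ω := by
  simp only [markovBridge, max_eq_left htr, max_eq_left (hst.trans htr)]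
  field_simp
  ring

theorem markovBridge_eq_zero {ρ : ℝ → ℝ} {s r : ℝ} (hrs : r ≤ s) (hs : ρ s ≠ 0) (ω : Ω) :
    markovBridge ρ X s r ω = 0 := by
  simp [markovBridge, max_eq_right hrs, hs]

theorem measurable_markovBridge {ρ : ℝ → ℝ} (hρcont : ContinuousOn ρ (Ici 0)) (hρ0 : ρ 0 = 0)
    (hρpos : ∀ t, 0 < t → 0 < ρ t) (hXcont : ∀ ω, ContinuousOn (fun t => X t ω) (Ici 0))
    {s : ℝ} (hs : 0 ≤ s) {m : MeasurableSpace Ω} (hX : ∀ u, s ≤ u → Measurable[m] (X u)) :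
    Measurable fun p : ℝ × Ω => markovBridge ρ X s p.1 p.2 := by
  rcases hs.eq_or_lt with rfl | hs'
  · simpa [markovBridge, hρ0, Function.comp_def] using (hX 0 le_rfl).comp measurable_snd
  refine measurable_uncurry_of_continuous_of_measurable (u := markovBridge ρ X s)
    (fun ω => ?_) (fun r => ?_)
  · have hmax : Continuous fun r : ℝ => max r s := by fun_prop
    have hρ' : Continuous fun r : ℝ => ρ (max r s) :=
      hρcont.comp_continuous hmax fun r => hs.trans (le_max_right r s)
    have hX' : Continuous fun r : ℝ => X (max r s) ω :=
      (hXcont ω).comp_continuous hmax fun r => hs.trans (le_max_right r s)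
    exact continuous_const.sub ((continuous_const.div hρ' fun r =>
      (hρpos _ (hs'.trans_le (le_max_right r s))).ne').mul hX')
  · exact (hX s le_rfl).sub (measurable_const.mul (hX _ (le_max_right r s)))

variable {R : ℝ → ℝ → ℝ} {ρ q : ℝ → ℝ}

theorem map_sub_const_mul_eq_gaussianReal
    (hGauss : ∀ (m : ℕ) (ts : Fin m → ℝ), (∀ i, 0 ≤ ts i) → ∀ c : Fin m → ℝ,
      ∃ v : NNReal, Measure.map (fun ω => ∑ i, c i * X (ts i) ω) P = gaussianReal 0 v)
    (hXmeas : ∀ t, Measurable (X t)) (hR : ∀ s t, R s t = ∫ ω, X s ω * X t ω ∂P)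
    {s r c : ℝ} (hs : 0 ≤ s) (hr : 0 ≤ r) :
    P.map (fun ω => X s ω - c * X r ω) =
      gaussianReal 0 (R s s - 2 * c * R s r + c ^ 2 * R r r).toNNReal := by
  have hG := isGaussianProcess_of_forall_sum hGauss hXmeas
  have hLs : MemLp (X s) 2 P := (hG.hasGaussianLaw_eval ⟨s, hs⟩).memLp_two
  have hLr : MemLp (X r) 2 P := (hG.hasGaussianLaw_eval ⟨r, hr⟩).memLp_two
  obtain ⟨v, hv⟩ := hGauss 2 ![s, r] (by simp [Fin.forall_fin_two, hs, hr]) ![1, -c]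
  simp only [Fin.sum_univ_two, Matrix.cons_val_zero, Matrix.cons_val_one, one_mul, neg_mul,
    ← sub_eq_add_neg] at hv
  have hm : AEMeasurable (fun ω => X s ω - c * X r ω) P :=
    ((hXmeas s).sub ((hXmeas r).const_mul c)).aemeasurable
  have h1 : (v : ℝ) = ∫ ω, (X s ω - c * X r ω) ^ 2 ∂P := by
    rw [← variance_id_gaussianReal (μ := 0) (v := v), ← hv, variance_id_map hm,
      variance_of_integral_eq_zero hm]
    have h0 : ∫ x, x ∂(P.map fun ω => X s ω - c * X r ω) = ∫ ω, (X s ω - c * X r ω) ∂P :=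
      integral_map hm (by fun_prop)
    rw [← h0, hv, integral_id_gaussianReal]
  have h2 : (v : ℝ) = R s s - 2 * c * R s r + c ^ 2 * R r r := by
    have e : (fun ω => (X s ω - c * X r ω) ^ 2) = fun ω =>
        X s ω * X s ω - 2 * c * (X s ω * X r ω) + c ^ 2 * (X r ω * X r ω) := by
      ext ω; ring
    rw [h1, hR, hR, hR, e, integral_add, integral_sub, integral_const_mul, integral_const_mul]
    · exact hLs.integrable_mul hLs
    · exact (hLs.integrable_mul hLr).const_mul _
    · exact (hLs.integrable_mul hLs).sub ((hLs.integrable_mul hLr).const_mul _)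
    · exact (hLr.integrable_mul hLr).const_mul _
  rw [hv, ← h2, Real.toNNReal_coe]

theorem indep_iSup_markovBridge [IsProbabilityMeasure P]
    (hGauss : ∀ (m : ℕ) (ts : Fin m → ℝ), (∀ i, 0 ≤ ts i) → ∀ c : Fin m → ℝ,
      ∃ v : NNReal, Measure.map (fun ω => ∑ i, c i * X (ts i) ω) P = gaussianReal 0 v)
    (hXmeas : ∀ t, Measurable (X t)) (hR : ∀ s t, R s t = ∫ ω, X s ω * X t ω ∂P)
    (hfact : ∀ s t, 0 ≤ s → 0 ≤ t → R s t = ρ (min s t) * q (max s t))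
    {t : ℝ} (ht : 0 ≤ t) (hρt : ρ t ≠ 0) :
    Indep (⨆ s : Icc 0 t, MeasurableSpace.comap (fun ω => X s ω - ρ s / ρ t * X t ω) inferInstance)
      (⨆ u : Ici t, MeasurableSpace.comap (X u) inferInstance) P := by
  have hG := isGaussianProcess_of_forall_sum hGauss hXmeas
  have hL {u : ℝ} (hu : 0 ≤ u) : MemLp (X u) 2 P := (hG.hasGaussianLaw_eval ⟨u, hu⟩).memLp_two
  have hcov {a b : ℝ} (ha : 0 ≤ a) (hb : 0 ≤ b) : cov[X a, X b; P] = R a b := by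
    rw [covariance_eq_sub (hL ha) (hL hb), integral_eq_zero_of_forall_sum hGauss hXmeas ha, hR]
    simp
  have h : IndepFun (fun ω (s : Icc 0 t) => X s ω - ρ s / ρ t * X t ω)
      (fun ω (u : Ici t) => X u ω) P := by
    refine IsGaussianProcess.indepFun_of_covariance_eq_zero
      (X := fun (s : Icc 0 t) ω => X s ω - ρ s / ρ t * X t ω) (Y := fun (u : Ici t) ω => X u ω)
      (hG.of_isGaussianProcess ?_)
      (fun s => ((hXmeas s).sub ((hXmeas t).const_mul _)).aemeasurable)
      (fun u => (hXmeas u).aemeasurable) fun s u => ?_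
    · classical
      rintro (s | u)
      · exact ⟨{⟨s, s.2.1⟩, ⟨t, ht⟩}, ContinuousLinearMap.proj ⟨⟨s, s.2.1⟩, by simp⟩ -
          (ρ s / ρ t) • ContinuousLinearMap.proj ⟨⟨t, ht⟩, by simp⟩, fun ω => by simp⟩
      · exact ⟨{⟨u, ht.trans u.2⟩}, ContinuousLinearMap.proj ⟨⟨u, ht.trans u.2⟩, by simp⟩,
          fun ω => by simp⟩
    · have hs := s.2.1
      have hu : t ≤ u := u.2
      rw [covariance_fun_sub_left (hL hs) ((hL ht).const_mul _) (hL (ht.trans hu)),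
        covariance_const_mul_left, hcov hs (ht.trans hu), hcov ht (ht.trans hu),
        hfact _ _ hs (ht.trans hu), hfact _ _ ht (ht.trans hu), min_eq_left hu,
        min_eq_left (s.2.2.trans hu), max_eq_right hu, max_eq_right (s.2.2.trans hu)]
      field_simp
      ring
  rw [IndepFun_iff_Indep] at h
  simpa only [MeasurableSpace.pi, MeasurableSpace.comap_iSup, MeasurableSpace.comap_comp,
    Function.comp_def] using h

/-- The variance at time `s` of the bridge of length `r > s`. -/
noncomputable def bridgeVar (ρ q : ℝ → ℝ) (s r : ℝ) : ℝ :=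
  ρ s * q s - ρ s ^ 2 / ρ (max r s) * q (max r s)

theorem measurable_gaussianPDFReal_bridgeVar
    (hρcont : ContinuousOn ρ (Ici 0)) (hqcont : ContinuousOn q (Ici 0))
    (hρpos : ∀ t, 0 < t → 0 < ρ t) {s : ℝ} (hs : 0 < s) :
    Measurable fun z : ℝ × ℝ => gaussianPDFReal 0 (bridgeVar ρ q s z.1).toNNReal z.2 := by
  have hmax : Continuous fun r : ℝ => max r s := by fun_prop
  have hρ' : Continuous fun r : ℝ => ρ (max r s) :=
    hρcont.comp_continuous hmax fun r => hs.le.trans (le_max_right r s)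
  have hq' : Continuous fun r : ℝ => q (max r s) :=
    hqcont.comp_continuous hmax fun r => hs.le.trans (le_max_right r s)
  have hV : Measurable (bridgeVar ρ q s) :=
    (continuous_const.sub ((continuous_const.div hρ' fun r =>
      (hρpos _ (hs.trans_le (le_max_right r s))).ne').mul hq')).measurable
  exact measurable_uncurry_gaussianPDFReal.comp
    (measurable_const.prodMk ((hV.comp measurable_fst).real_toNNReal.prodMk measurable_snd))

theorem bridgeVar_eq (hfact : ∀ s t, 0 ≤ s → 0 ≤ t → R s t = ρ (min s t) * q (max s t))
    (hρpos : ∀ t, 0 < t → 0 < ρ t) (hqpos : ∀ t, 0 < t → 0 < q t)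
    {s r : ℝ} (hs : 0 < s) (hsr : s < r) :
    bridgeVar ρ q s r = (R r r * R s s - R r s ^ 2) / R r r := by
  have hr := hs.trans hsr
  have := (hρpos r hr).ne'
  have := (hqpos r hr).ne'
  rw [bridgeVar, hfact _ _ hr.le hr.le, hfact _ _ hs.le hs.le, hfact _ _ hr.le hs.le]
  simp only [min_self, max_self, min_eq_right hsr.le, max_eq_left hsr.le]
  field_simp

theorem bridgeVar_pos (hfact : ∀ s t, 0 ≤ s → 0 ≤ t → R s t = ρ (min s t) * q (max s t))
    (hρpos : ∀ t, 0 < t → 0 < ρ t) (hqpos : ∀ t, 0 < t → 0 < q t)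
    (hRpos : ∀ t, 0 < t → 0 < R t t)
    (hRnd : ∀ s t, 0 < s → 0 < t → s ≠ t → (R s t) ^ 2 < R s s * R t t)
    {s r : ℝ} (hs : 0 < s) (hsr : s < r) : 0 < bridgeVar ρ q s r := by
  rw [bridgeVar_eq hfact hρpos hqpos hs hsr]
  exact div_pos (sub_pos.2 (hRnd r s (hs.trans hsr) hs hsr.ne')) (hRpos r (hs.trans hsr))

theorem map_restrict_prodMk_markovBridge [IsProbabilityMeasure P]
    (hGauss : ∀ (m : ℕ) (ts : Fin m → ℝ), (∀ i, 0 ≤ ts i) → ∀ c : Fin m → ℝ,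
      ∃ v : NNReal, Measure.map (fun ω => ∑ i, c i * X (ts i) ω) P = gaussianReal 0 v)
    (hXmeas : ∀ t, Measurable (X t)) (hXcont : ∀ ω, ContinuousOn (fun t => X t ω) (Ici 0))
    (hR : ∀ s t, R s t = ∫ ω, X s ω * X t ω ∂P)
    (hfact : ∀ s t, 0 ≤ s → 0 ≤ t → R s t = ρ (min s t) * q (max s t))
    (hρcont : ContinuousOn ρ (Ici 0)) (hqcont : ContinuousOn q (Ici 0)) (hρ0 : ρ 0 = 0)
    (hρpos : ∀ t, 0 < t → 0 < ρ t) (hqpos : ∀ t, 0 < t → 0 < q t)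
    (hRpos : ∀ t, 0 < t → 0 < R t t)
    (hRnd : ∀ s t, 0 < s → 0 < t → s ≠ t → (R s t) ^ 2 < R s s * R t t)
    {τ : Ω → ℝ} (hτ : Measurable τ)
    (hindep : Indep (MeasurableSpace.comap τ inferInstance)
      (⨆ t ∈ Ici (0 : ℝ), MeasurableSpace.comap (X t) inferInstance) P)
    {s : ℝ} (hs : 0 < s) :
    (P.restrict (τ ⁻¹' Ioi s)).map (fun ω => (τ ω, markovBridge ρ X s (τ ω) ω)) =
      (((P.map τ).restrict (Ioi s)).prod volume).withDensity fun z =>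
        ENNReal.ofReal (gaussianPDFReal 0 (bridgeVar ρ q s z.1).toNNReal z.2) := by
  have hle : (⨆ t ∈ Ici (0 : ℝ), MeasurableSpace.comap (X t) inferInstance) ≤ mΩ :=
    iSup₂_le fun u _ => (hXmeas u).comap_le
  refine map_restrict_prodMk_eq_withDensity
    (mΩ' := ⨆ t ∈ Ici (0 : ℝ), MeasurableSpace.comap (X t) inferInstance) (W := id) hτ
    (measurable_id'' hle) ?_ (Z := fun p => markovBridge ρ X s p.1 p.2)
    (measurable_markovBridge hρcont hρ0 hρpos hXcont hs.le fun u hu => ?_)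
    (measurable_gaussianPDFReal_bridgeVar hρcont hqcont hρpos hs).ennreal_ofReal
    measurableSet_Ioi fun r hr => ?_
  · refine (IndepFun_iff_Indep (mγ := ⨆ t ∈ Ici (0 : ℝ), MeasurableSpace.comap (X t) inferInstance)
      _ _ _).2 ?_
    rwa [MeasurableSpace.comap_id]
  · exact Measurable.of_comap_le (le_iSup₂_of_le u (hs.le.trans hu) le_rfl)
  · have hr' : s < r := hr
    have hr0 := hs.trans hr'
    have hV := bridgeVar_pos hfact hρpos hqpos hRpos hRnd hs hr'
    simp only [markovBridge, id, max_eq_left hr'.le]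
    rw [map_sub_const_mul_eq_gaussianReal hGauss hXmeas hR hs.le hr0.le]
    have e : R s s - 2 * (ρ s / ρ r) * R s r + (ρ s / ρ r) ^ 2 * R r r = bridgeVar ρ q s r := by
      have := (hρpos r hr0).ne'
      rw [bridgeVar, hfact _ _ hr0.le hr0.le, hfact _ _ hs.le hs.le, hfact _ _ hs.le hr0.le]
      simp only [min_self, max_self, min_eq_left hr'.le, max_eq_right hr'.le, max_eq_left hr'.le]
      field_simp
      ring
    rw [e, gaussianReal_of_var_ne_zero _ (by simpa using hV)]
    rfl

end Gaussian

theorem ae_snd_ne_of_map_eq_withDensity {Ω α : Type*} {mΩ : MeasurableSpace Ω}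
    {mα : MeasurableSpace α} {Q : Measure Ω} {Y : Ω → α × ℝ} (hY : Measurable Y) {μ : Measure α}
    {f : α × ℝ → ENNReal} (h : Q.map Y = (μ.prod volume).withDensity f) (x : ℝ) :
    ∀ᵐ ω ∂Q, (Y ω).2 ≠ x := by
  have h0 : (μ.prod (volume : Measure ℝ)) (Prod.snd ⁻¹' {x}) = 0 := by
    rw [← univ_prod, Measure.prod_prod]
    simp
  have h1 := withDensity_absolutelyContinuous (μ.prod (volume : Measure ℝ)) f h0
  rw [← h, Measure.map_apply hY (measurable_snd (measurableSet_singleton x))] at h1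
  rw [ae_iff]
  simpa [preimage, mem_singleton_iff] using h1

theorem measurableSet_of_ae_eq_of_forall_null {Ω : Type*} {m mΩ : MeasurableSpace Ω}
    {P : Measure Ω} (hm : ∀ s : Set Ω, P s = 0 → MeasurableSet[m] s) {s u : Set Ω}
    (hs : MeasurableSet[m] s) (h : s =ᵐ[P] u) : MeasurableSet[m] u := by
  obtain ⟨h1, h2⟩ := ae_eq_set.1 h
  have e : u = (s \ (s \ u)) ∪ (u \ s) := by
    ext ω; by_cases ω ∈ s <;> by_cases ω ∈ u <;> simp_all
  rw [e]
  exact MeasurableSet.union (MeasurableSet.diff hs (hm _ h1)) (hm _ h2)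

theorem ae_eq_set_inter_of_ae_eq_restrict {Ω : Type*} {mΩ : MeasurableSpace Ω}
    {P : Measure Ω} {s u v : Set Ω} (hv : MeasurableSet v) (h : s =ᵐ[P.restrict v] u) :
    (s ∩ v : Set Ω) =ᵐ[P] (u ∩ v : Set Ω) := by
  filter_upwards [(ae_restrict_iff' hv).1 h] with ω hω
  refine propext (and_congr_left fun h => ?_)
  exact (hω h).to_iff

section CompletedPast

variable {Ω : Type*} {mΩ : MeasurableSpace Ω} {P : Measure Ω} {ξ : ℝ → Ω → ℝ} {t : ℝ}

/-- The natural σ-algebra of `ξ` at time `t`, augmented by the null sets of `P`. -/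
@[reducible] def completedPast (P : Measure Ω) (ξ : ℝ → Ω → ℝ) (t : ℝ) : MeasurableSpace Ω :=
  (⨆ s ∈ Icc (0 : ℝ) t, MeasurableSpace.comap (ξ s) inferInstance) ⊔
    MeasurableSpace.generateFrom {s : Set Ω | P s = 0}

theorem completedPast_le (hcomplete : ∀ s : Set Ω, P s = 0 → MeasurableSet s)
    (hξ : ∀ s ∈ Icc 0 t, Measurable (ξ s)) : completedPast P ξ t ≤ mΩ :=
  sup_le (iSup₂_le fun s hs => (hξ s hs).comap_le) (MeasurableSpace.generateFrom_le hcomplete)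

theorem measurableSet_completedPast_of_null {s : Set Ω} (hs : P s = 0) :
    MeasurableSet[completedPast P ξ t] s :=
  le_sup_right (a := ⨆ s ∈ Icc (0 : ℝ) t, MeasurableSpace.comap (ξ s) inferInstance) s
    (MeasurableSpace.measurableSet_generateFrom hs)

theorem measurable_completedPast {s : ℝ} (hs : s ∈ Icc 0 t) :
    Measurable[completedPast P ξ t] (ξ s) :=
  Measurable.of_comap_le (le_sup_of_le_left (le_iSup₂_of_le s hs le_rfl))

theorem measurable_min_completedPast {τ : Ω → ℝ} (hτpos : ∀ ω, 0 < τ ω)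
    (hzero : ∀ s, 0 < s → ∀ᵐ ω ∂P, ξ s ω = 0 ↔ τ ω ≤ s) :
    Measurable[completedPast P ξ t] fun ω => min (τ ω) t := by
  refine measurable_of_Iic fun x => ?_
  rcases le_or_gt t x with hx | hx
  · convert MeasurableSet.univ
    ext ω; simp [hx]
  rcases le_or_gt x 0 with hx0 | hx0
  · convert MeasurableSet.empty
    ext ω; simp [hx, (hx0.trans_lt (hτpos ω))]
  · refine measurableSet_of_ae_eq_of_forall_null (fun _ => measurableSet_completedPast_of_null)
      (measurable_completedPast ⟨hx0.le, hx.le⟩ (measurableSet_singleton 0)) ?_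
    filter_upwards [hzero x hx0] with ω hω
    refine propext ?_
    change ξ x ω = 0 ↔ min (τ ω) t ≤ x
    rw [hω]
    simp [hx.not_ge]

theorem completedPast_le_eventuallyMeasurableSpace {S : Set Ω} {mY : MeasurableSpace Ω}
    {Y : ℝ → Ω → ℝ} {c : ℝ → ℝ} (hY : ∀ s ∈ Icc 0 t, Measurable[mY] (Y s))
    (h : ∀ s ∈ Icc 0 t, ξ s =ᵐ[P.restrict S] fun ω => Y s ω + c s * ξ t ω) :
    completedPast P ξ t ≤ eventuallyMeasurableSpace
      (mY ⊔ MeasurableSpace.comap (ξ t) inferInstance) (ae (P.restrict S)) := by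
  refine sup_le (iSup₂_le fun s hs => ?_) (MeasurableSpace.generateFrom_le fun s hs => ?_)
  · have hYs : Measurable[mY ⊔ MeasurableSpace.comap (ξ t) inferInstance]
        fun ω => Y s ω + c s * ξ t ω :=
      Measurable.add ((hY s hs).mono le_sup_left le_rfl)
        (Measurable.const_mul (Measurable.of_comap_le le_sup_right) _)
    exact Measurable.comap_le (hYs.eventuallyMeasurable_of_eventuallyEq (h s hs))
  · exact ⟨∅, @MeasurableSet.empty _ (_),
      ae_eq_empty.2 (Measure.restrict_le_self.absolutelyContinuous hs)⟩

end CompletedPast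

theorem setIntegral_indicator_sub_eq_zero {Ω : Type*} {mF mY mW mΩ : MeasurableSpace Ω}
    {P : Measure Ω} [IsProbabilityMeasure P] (hYle : mY ≤ mΩ) (hWle : mW ≤ mΩ)
    (hYW : Indep mY mW P) {S : Set Ω} (hS : MeasurableSet[mW] S) {Z u v : Ω → ℝ}
    (hZ : Measurable[mW] Z) (hu : Measurable[mW] u) (hv : Measurable[mW] v)
    (hui : IntegrableOn u S P) (hvi : IntegrableOn v S P)
    (huv : ∀ B : Set ℝ, MeasurableSet B →
      ∫ ω in Z ⁻¹' B ∩ S, u ω ∂P = ∫ ω in Z ⁻¹' B ∩ S, v ω ∂P)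
    (hF : mF ≤ eventuallyMeasurableSpace
      (mY ⊔ MeasurableSpace.comap Z inferInstance) (ae (P.restrict S)))
    {s : Set Ω} (hs : MeasurableSet[mF] s) :
    ∫ ω in s, S.indicator (fun ω => u ω - v ω) ω ∂P = 0 := by
  have hSm : MeasurableSet S := hWle S hS
  obtain ⟨w, hw, hsw⟩ := hF s hs
  have hw0 : ∫ ω in w, S.indicator (fun ω => u ω - v ω) ω ∂P = 0 := by
    refine setIntegral_eq_zero_of_indep hYle hWle hZ.comap_le hYW
      ((hu.sub hv).indicator hS).stronglyMeasurable ((hui.sub hvi).integrable_indicator hSm) ?_ hw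
    rintro _ ⟨B, hB, rfl⟩
    change ∫ ω in Z ⁻¹' B, S.indicator (fun ω => u ω - v ω) ω ∂P = 0
    rw [setIntegral_indicator hSm, integral_sub, huv B hB, sub_self]
    · exact hui.mono_set inter_subset_right
    · exact hvi.mono_set inter_subset_right
  rw [← hw0, setIntegral_indicator hSm, setIntegral_indicator hSm]
  exact setIntegral_congr_set (ae_eq_set_inter_of_ae_eq_restrict hSm hsw)

/-- Bayes estimate of τ given the whole past: for t > 0 and E[|g(τ)|] < ∞,
E[g(τ) | F_t^{ξ,c}] = g(τ ∧ t)·1_{ξ_t = 0} + ∫_{(t,∞)} g(r) ϕ_{ξ^r_t}(ξ_t) ℙ_τ(dr)·1_{ξ_t ≠ 0}. -/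
theorem stmt_16
    {Ω : Type*} [MeasurableSpace Ω] (P : Measure Ω) [IsProbabilityMeasure P]
    (X : ℝ → Ω → ℝ)
    (hXmeas : ∀ t, Measurable (X t))
    (hGauss : ∀ (m : ℕ) (ts : Fin m → ℝ), (∀ i, 0 ≤ ts i) → ∀ c : Fin m → ℝ,
      ∃ v : NNReal, Measure.map (fun ω => ∑ i, c i * X (ts i) ω) P = gaussianReal 0 v)
    (hXcont : ∀ ω, ContinuousOn (fun t => X t ω) (Set.Ici 0))
    (hX0 : ∀ᵐ ω ∂P, X 0 ω = 0)
    (R : ℝ → ℝ → ℝ)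
    (hR : ∀ s t, R s t = ∫ ω, X s ω * X t ω ∂P)
    (hRpos : ∀ t, 0 < t → 0 < R t t)
    (hRnd : ∀ s t, 0 < s → 0 < t → s ≠ t → (R s t)^2 < R s s * R t t)
    (ξr : ℝ → ℝ → Ω → ℝ)
    (hξr : ∀ r t ω, ξr r t ω = X t ω - R t (max r t) / R (max r t) (max r t) * X (max r t) ω)
    (τ : Ω → ℝ) (hτmeas : Measurable τ) (hτpos : ∀ ω, 0 < τ ω)
    (hindep : Indep (MeasurableSpace.comap τ inferInstance)
      (⨆ t ∈ Set.Ici (0:ℝ), MeasurableSpace.comap (X t) inferInstance) P)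
    (F : ℝ → ℝ) (hF : ∀ t, F t = (P {ω | τ ω ≤ t}).toReal)
    (ξ : ℝ → Ω → ℝ) (hξ : ∀ t ω, ξ t ω = ξr (τ ω) t ω)
    (ρ q : ℝ → ℝ)
    (hfact : ∀ s t, 0 ≤ s → 0 ≤ t → R s t = ρ (min s t) * q (max s t))
    (hρcont : ContinuousOn ρ (Set.Ici 0)) (hqcont : ContinuousOn q (Set.Ici 0))
    (hρ0 : ρ 0 = 0)
    (hρpos : ∀ t, 0 < t → 0 < ρ t) (hqpos : ∀ t, 0 < t → 0 < q t)
    (hρq : MonotoneOn (fun t => ρ t / q t) (Set.Ioi 0))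
    (p : ℝ → ℝ → ℝ → ℝ)
    (hp : ∀ v x y, 0 < v →
      p v x y = (Real.sqrt (2 * Real.pi * v))⁻¹ * Real.exp (-(x - y)^2 / (2*v)))
    (A : ℝ → ℝ → ℝ) (hA : ∀ t s, A t s = R s s * R t t - R s t ^ 2)
    (φ : ℝ → ℝ → ℝ → ℝ) (hφ : ∀ t r x, 0 < t → t < r → φ t r x = p (A t r / R r r) x 0)
    (ϕ : ℝ → ℝ → ℝ → ℝ)
    (hϕ : ∀ t r x, 0 < t → t < r →
      ϕ t r x = φ t r x / ∫ s in Set.Ioi t, φ t s x ∂(Measure.map τ P))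
    (hcomplete : ∀ s : Set Ω, P s = 0 → MeasurableSet s)
    (t : ℝ) (ht : 0 < t)
    (g : ℝ → ℝ) (hgmeas : Measurable g) (hgint : Integrable (fun ω => g (τ ω)) P) :
    P[(fun ω => g (τ ω))|(⨆ s ∈ Set.Icc (0:ℝ) t,
        MeasurableSpace.comap (ξ s) inferInstance) ⊔
      MeasurableSpace.generateFrom {s : Set Ω | P s = 0}] =ᵐ[P]
      fun ω => g (min (τ ω) t) * (if ξ t ω = 0 then 1 else 0)
        + (∫ r in Set.Ioi t, g r * ϕ t r (ξ t ω) ∂(Measure.map τ P)) *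
            (if ξ t ω ≠ 0 then 1 else 0) := by
  have hB : ∀ s, 0 ≤ s → ∀ ω, ξ s ω = markovBridge ρ X s (τ ω) ω := by
    intro s hs ω
    have hm : 0 ≤ max (τ ω) s := hs.trans (le_max_right _ _)
    have hm' : 0 < max (τ ω) s := (hτpos ω).trans_le (le_max_left _ _)
    have hq := (hqpos _ hm').ne'
    rw [hξ, hξr, markovBridge, hfact s _ hs hm, hfact _ _ hm hm, min_self, max_self,
      min_eq_left (le_max_right _ _), max_eq_right (le_max_right _ _), mul_div_mul_right _ _ hq]
  have hpair : ∀ s, 0 ≤ s → Measurable fun ω => (τ ω, markovBridge ρ X s (τ ω) ω) :=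
    fun s hs => hτmeas.prodMk ((measurable_markovBridge hρcont hρ0 hρpos hXcont hs
      fun u _ => hXmeas u).comp (hτmeas.prodMk measurable_id))
  have hξmeas : ∀ s, 0 ≤ s → Measurable (ξ s) := by
    intro s hs
    rw [funext (hB s hs)]
    exact measurable_snd.comp (hpair s hs)
  have hlaw : ∀ s : ℝ, 0 < s → _ := fun s hs => map_restrict_prodMk_markovBridge hGauss hXmeas hXcont hR
    hfact hρcont hqcont hρ0 hρpos hqpos hRpos hRnd hτmeas hindep (s := s) hs
  have hzero : ∀ s, 0 < s → ∀ᵐ ω ∂P, ξ s ω = 0 ↔ τ ω ≤ s := by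
    intro s hs
    have h := ae_snd_ne_of_map_eq_withDensity (hpair s hs.le) (hlaw s hs) 0
    rw [ae_restrict_iff' (hτmeas measurableSet_Ioi)] at h
    filter_upwards [h] with ω hω
    rw [hB s hs.le]
    refine ⟨fun h0 => ?_, fun hle => markovBridge_eq_zero hle (hρpos s hs).ne' ω⟩
    by_contra! hlt
    exact hω hlt h0
  set S : Set Ω := τ ⁻¹' Ioi t with hS
  have hSmeas : MeasurableSet S := hτmeas measurableSet_Ioi
  change P[_|completedPast P ξ t] =ᵐ[P] _
  set f : ℝ × ℝ → ℝ := fun z => gaussianPDFReal 0 (bridgeVar ρ q t z.1).toNNReal z.2 with hf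
  have hfmeas : Measurable f := measurable_gaussianPDFReal_bridgeVar hρcont hqcont hρpos ht
  have hf0 : 0 ≤ f := fun z => gaussianPDFReal_nonneg _ _ _
  set μ : Measure ℝ := (P.map τ).restrict (Ioi t) with hμ
  have : IsProbabilityMeasure (P.map τ) := Measure.isProbabilityMeasure_map hτmeas.aemeasurable
  set H : ℝ → ℝ := fun x => (∫ r, g r * f (r, x) ∂μ) / ∫ r, f (r, x) ∂μ with hH
  have hHmeas : Measurable H := measurable_bayes hfmeas hgmeas
  have hφf : ∀ x, ∀ r ∈ Ioi t, φ t r x = f (r, x) := by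
    intro x r hr
    have hV := bridgeVar_pos hfact hρpos hqpos hRpos hRnd ht hr
    rw [hφ t r x ht hr, hA, ← bridgeVar_eq hfact hρpos hqpos ht hr, hp _ _ _ hV]
    simp only [hf, gaussianPDFReal, Real.coe_toNNReal _ hV.le]
  have hGH : ∀ x, ∫ r, g r * ϕ t r x ∂μ = H x := by
    intro x
    have h1 : ∫ s in Ioi t, φ t s x ∂(P.map τ) = ∫ r, f (r, x) ∂μ :=
      setIntegral_congr_fun measurableSet_Ioi (hφf x)
    rw [show H x = (∫ r, g r * f (r, x) ∂μ) / ∫ r, f (r, x) ∂μ from rfl, ← integral_div]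
    refine setIntegral_congr_fun measurableSet_Ioi fun r hr => ?_
    change g r * ϕ t r x = g r * f (r, x) / ∫ r, f (r, x) ∂μ
    rw [hϕ t r x ht hr, h1, hφf x r hr, mul_div_assoc]
  simp only [hGH]
  have hlawt : (P.restrict S).map (fun ω => (τ ω, ξ t ω)) =
      (μ.prod volume).withDensity fun z => ENNReal.ofReal (f z) := by
    simp only [hB t ht.le]
    exact hlaw t ht
  have hpt : Measurable fun ω => (τ ω, ξ t ω) := hτmeas.prodMk (hξmeas t ht.le)
  have hfin : IsFiniteMeasure ((μ.prod volume).withDensity fun z => ENNReal.ofReal (f z)) := by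
    rw [← hlawt]
    infer_instance
  have hg1 : Measurable fun z : ℝ × ℝ => g z.1 := hgmeas.comp measurable_fst
  have hH2 : Measurable fun z : ℝ × ℝ => H z.2 := hHmeas.comp measurable_snd
  have hgi : Integrable (fun z : ℝ × ℝ => g z.1)
      ((μ.prod volume).withDensity fun z => ENNReal.ofReal (f z)) := by
    rw [← hlawt, integrable_map_measure hg1.aestronglyMeasurable hpt.aemeasurable]
    exact hgint.restrict
  have hHi : IntegrableOn (fun ω => H (ξ t ω)) S P := by
    have h : Integrable (fun z : ℝ × ℝ => H z.2) _ := integrable_bayes hfmeas hf0 hgmeas hgi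
    rwa [← hlawt, integrable_map_measure hH2.aestronglyMeasurable hpt.aemeasurable] at h
  have hbayes : ∀ B : Set ℝ, MeasurableSet B →
      ∫ ω in ξ t ⁻¹' B ∩ S, H (ξ t ω) ∂P = ∫ ω in ξ t ⁻¹' B ∩ S, g (τ ω) ∂P := by
    intro B hBm
    have h : ∫ z in Prod.snd ⁻¹' B, H z.2 ∂_ = _ := setIntegral_bayes hfmeas hf0 hgmeas hgi hBm
    rw [← hlawt, setIntegral_map (measurable_snd hBm) hH2.aestronglyMeasurable hpt.aemeasurable,
      setIntegral_map (measurable_snd hBm) hg1.aestronglyMeasurable hpt.aemeasurable,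
      Measure.restrict_restrict (hpt (measurable_snd hBm))] at h
    exact h
  set h : Ω → ℝ := S.indicator fun ω => H (ξ t ω) - g (τ ω) with hh
  have hhint : Integrable h P := (hHi.sub hgint.integrableOn).integrable_indicator hSmeas
  have hXX : ∀ u, 0 ≤ u →
      Measurable[⨆ t ∈ Ici (0 : ℝ), MeasurableSpace.comap (X t) inferInstance] (X u) :=
    fun u hu => Measurable.of_comap_le (le_iSup₂_of_le u hu le_rfl)
  have hYle : (⨆ s : Icc 0 t, MeasurableSpace.comap (fun ω => X s ω - ρ s / ρ t * X t ω)
      inferInstance) ≤ ‹MeasurableSpace Ω› :=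
    iSup_le fun s => ((hXmeas s).sub ((hXmeas t).const_mul _)).comap_le
  have hZle : (⨆ u : Ici t, MeasurableSpace.comap (X u) inferInstance) ≤ ‹MeasurableSpace Ω› :=
    iSup_le fun u => (hXmeas u).comap_le
  have hYW := Indep.sup_right_of_indep hYle hZle hτmeas.comap_le
    (indep_iSup_markovBridge hGauss hXmeas hR hfact ht.le (hρpos t ht).ne')
    (indep_of_indep_of_le_right hindep (sup_le
      (iSup_le fun s => ((hXX s s.2.1).sub ((hXX t ht.le).const_mul _)).comap_le)
      (iSup_le fun u => (hXX u (ht.le.trans u.2)).comap_le)))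
  have hτW : Measurable[MeasurableSpace.comap τ inferInstance ⊔
      ⨆ u : Ici t, MeasurableSpace.comap (X u) inferInstance] τ :=
    Measurable.of_comap_le le_sup_left
  have hξW : Measurable[MeasurableSpace.comap τ inferInstance ⊔
      ⨆ u : Ici t, MeasurableSpace.comap (X u) inferInstance] (ξ t) := by
    rw [funext (hB t ht.le)]
    exact (measurable_markovBridge
      (m := MeasurableSpace.comap τ inferInstance ⊔
        ⨆ u : Ici t, MeasurableSpace.comap (X u) inferInstance)
      hρcont hρ0 hρpos hXcont ht.le fun u hu =>
      Measurable.of_comap_le (le_sup_of_le_right (le_iSup_of_le (⟨u, hu⟩ : Ici t) le_rfl))).comp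
        (hτW.prodMk (@measurable_id _ (_)))
  have hF0 : ∀ s, MeasurableSet[completedPast P ξ t] s → ∫ ω in s, h ω ∂P = 0 := by
    intro s hs
    refine setIntegral_indicator_sub_eq_zero hYle (sup_le hτmeas.comap_le hZle) hYW
      (hτW measurableSet_Ioi) hξW (hHmeas.comp hξW) (hgmeas.comp hτW) hHi hgint.integrableOn hbayes
      (completedPast_le_eventuallyMeasurableSpace (Y := fun s ω => X s ω - ρ s / ρ t * X t ω)
        (c := fun s => ρ s / ρ t) (fun s hs => ?_) fun s hs => ?_) hs
    · exact Measurable.of_comap_le (le_iSup_of_le (⟨s, hs⟩ : Icc 0 t) le_rfl)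
    · filter_upwards [ae_restrict_mem hSmeas] with ω hω
      rw [hB s hs.1, hB t ht.le]
      exact markovBridge_eq_add hs.2 (le_of_lt hω) (hρpos t ht).ne' ω
  set G : Ω → ℝ := fun ω => g (min (τ ω) t) * (if ξ t ω = 0 then 1 else 0) +
    H (ξ t ω) * (if ξ t ω ≠ 0 then 1 else 0) with hG
  have hGae : G =ᵐ[P] fun ω => g (τ ω) + h ω := by
    filter_upwards [hzero t ht] with ω hω
    by_cases hle : τ ω ≤ t
    · have : ω ∉ S := not_lt.2 hle
      simp [hG, hh, hω.2 hle, hle, this]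
    · have h1 : ω ∈ S := not_le.1 hle
      have h2 : ξ t ω ≠ 0 := fun h0 => hle (hω.1 h0)
      simp [hG, hh, h1, h2]
  have hGint : Integrable G P := (hgint.add hhint).congr hGae.symm
  have hξt : Measurable[completedPast P ξ t] (ξ t) := measurable_completedPast ⟨ht.le, le_rfl⟩
  have hGF : Measurable[completedPast P ξ t] G := by
    have hset : MeasurableSet[completedPast P ξ t] {ω | ξ t ω = 0} :=
      hξt (measurableSet_singleton 0)
    exact ((hgmeas.comp (measurable_min_completedPast hτpos hzero)).mul
      (Measurable.ite hset measurable_const measurable_const)).add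
        ((hHmeas.comp hξt).mul (Measurable.ite hset.compl measurable_const measurable_const))
  have hFle : completedPast P ξ t ≤ ‹MeasurableSpace Ω› :=
    completedPast_le hcomplete fun s hs => hξmeas s hs.1
  refine (ae_eq_condExp_of_forall_setIntegral_eq hFle hgint (fun _ _ _ => hGint.integrableOn)
    (fun s hs _ => ?_) hGF.stronglyMeasurable.aestronglyMeasurable).symm
  rw [setIntegral_congr_ae (hFle s hs) (hGae.mono fun _ h _ => h),
    integral_add hgint.integrableOn hhint.integrableOn, hF0 s hs, add_zero]
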